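/- Let H be an infinite-dimensional complex Hilbert space and let T be a bounded linear operator on H. Then T is absolutely norm attaining if and only if there exists α ≥ 0 such that the essential spectrum of the modulus |T| = (T*T)^{1/2} equals the singleton {α} and the spectrum σ(|T|) contains only finitely many elements strictly less than α. -/

import Mathlib

/-- A bounded operator `T` on a complex inner product space is *absolutely norm attaining*
if for every nonzero closed subspace `M`, some point of the closed unit ball of `M`
attains the supremum of `‖T x‖` over that ball. -/
def IsAbsNormAttaining {H : Type*} [NormedAddCommGroup H] [InnerProductSpace ℂ H]
    (T : H →L[ℂ] H) : Prop :=
  ∀ M : Submodule ℂ H, IsClosed (M : Set H) → M ≠ ⊥ →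
    ∃ x₀ ∈ M, ‖x₀‖ ≤ 1 ∧ ‖T x₀‖ = sSup ((fun x => ‖T x‖) '' {x : H | x ∈ M ∧ ‖x‖ ≤ 1})

/-- The *essential spectrum* of `T`: the spectrum of the image of `T` in the Calkin algebra,
i.e. the set of `λ` such that `T - λ·I` is not invertible modulo the compact operators. -/
def essSpectrum {H : Type*} [NormedAddCommGroup H] [InnerProductSpace ℂ H]
    (T : H →L[ℂ] H) : Set ℂ :=
  {lam : ℂ | ¬ ∃ S : H →L[ℂ] H,
      IsCompactOperator (S * (T - lam • 1) - 1 : H →L[ℂ] H) ∧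
      IsCompactOperator ((T - lam • 1) * S - 1 : H →L[ℂ] H)}


section AN
open ContinuousLinearMap
variable {H : Type*} [NormedAddCommGroup H] [InnerProductSpace ℂ H]

lemma an_congr {T A : H →L[ℂ] H} (h : ∀ x, ‖T x‖ = ‖A x‖) :
    IsAbsNormAttaining T ↔ IsAbsNormAttaining A := by
  unfold IsAbsNormAttaining
  simp only [h]

/-- the image set is bounded above -/
lemma an_bdd (T : H →L[ℂ] H) (M : Submodule ℂ H) :
    BddAbove ((fun x => ‖T x‖) '' {x : H | x ∈ M ∧ ‖x‖ ≤ 1}) := by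
  refine ⟨‖T‖, ?_⟩
  rintro _ ⟨x, ⟨_, hx⟩, rfl⟩
  exact (T.le_opNorm x).trans (by nlinarith [norm_nonneg T])

lemma an_le_sSup (T : H →L[ℂ] H) (M : Submodule ℂ H) (x : H) (hx : x ∈ M) :
    ‖T x‖ ≤ sSup ((fun x => ‖T x‖) '' {x : H | x ∈ M ∧ ‖x‖ ≤ 1}) * ‖x‖ := by
  by_cases h0 : x = 0
  · simp [h0]
  have hpos : 0 < ‖x‖ := norm_pos_iff.mpr h0
  have := le_csSup (an_bdd T M) ⟨((‖x‖⁻¹ : ℝ) : ℂ) • x, ⟨M.smul_mem _ hx, by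
    rw [norm_smul]; simp [hpos.ne']⟩, rfl⟩
  simp only [map_smul, norm_smul, Complex.norm_real, norm_inv, norm_norm] at this
  rw [inv_mul_le_iff₀ hpos] at this
  linarith

lemma an_variational [CompleteSpace H] {T : H →L[ℂ] H} (hT : IsAbsNormAttaining T)
    (M : Submodule ℂ H) (hM : IsClosed (M : Set H)) (hM0 : M ≠ ⊥) :
    ∃ x₀ ∈ M, ‖x₀‖ = 1 ∧ ∃ β : ℝ, 0 ≤ β ∧ (∀ x ∈ M, ‖T x‖ ≤ β * ‖x‖) ∧
      ∀ y ∈ M, inner ℂ (T y) (T x₀) = ((β ^ 2 : ℝ) : ℂ) * inner ℂ y x₀ := by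
  obtain ⟨x₀, hx₀, hx1, hx⟩ := hT M hM hM0
  have hle := an_le_sSup T M
  set β := sSup ((fun x => ‖T x‖) '' {x : H | x ∈ M ∧ ‖x‖ ≤ 1}) with hβ
  have hβ0 : 0 ≤ β := hx ▸ norm_nonneg _
  rcases hβ0.eq_or_lt with h0 | hpos
  · obtain ⟨v, hv, hv0⟩ := Submodule.exists_mem_ne_zero_of_ne_bot hM0
    have hz : ∀ x ∈ M, T x = 0 := fun x hx => by
      have := hle x hx
      rw [← h0, zero_mul] at this
      exact norm_le_zero_iff.mp this
    refine ⟨((‖v‖⁻¹ : ℝ) : ℂ) • v, M.smul_mem _ hv, ?_, 0, le_rfl, ?_, ?_⟩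
    · rw [norm_smul]; simp [hv0]
    · intro x hx; simp [hz x hx]
    · intro y hy; simp [hz y hy]
  · have hn : ‖x₀‖ = 1 := by
      refine le_antisymm hx1 ?_
      have := hle x₀ hx₀
      rw [hx] at this
      nlinarith
    refine ⟨x₀, hx₀, hn, β, hβ0, hle, ?_⟩
    have : CompleteSpace M := hM.completeSpace_coe
    set z := M.starProjection (adjoint T (T x₀)) with hz
    have hzM : z ∈ M := Submodule.starProjection_apply_mem _ _
    have key : ∀ y ∈ M, inner ℂ y z = inner ℂ (T y) (T x₀) := by
      intro y hy
      rw [hz, ← Submodule.inner_starProjection_left_eq_right, Submodule.starProjection_eq_self_iff.mpr hy,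
        adjoint_inner_right]
    have hzn : ‖z‖ ≤ β ^ 2 := by
      have h1 : ‖z‖ ^ 2 ≤ β ^ 2 * ‖z‖ := by
        have : ‖inner ℂ z z‖ ≤ ‖T z‖ * ‖T x₀‖ := by
          rw [key z hzM]; exact norm_inner_le_norm _ _
        rw [inner_self_eq_norm_sq_to_K] at this
        simp only [norm_pow, RCLike.norm_ofReal, abs_norm] at this
        rw [hx] at this
        nlinarith [hle z hzM]
      by_contra hc
      push Not at hc
      have : 0 < ‖z‖ := lt_of_le_of_lt (by positivity) hc
      nlinarith
    have hd : z = ((β ^ 2 : ℝ) : ℂ) • x₀ := by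
      rw [← sub_eq_zero, ← norm_le_zero_iff]
      have h2 : ‖z - ((β ^ 2 : ℝ) : ℂ) • x₀‖ ^ 2 ≤ 0 := by
        rw [@norm_sub_sq ℂ, inner_smul_right, ← inner_conj_symm, key x₀ hx₀, inner_self_eq_norm_sq_to_K,
          hx, norm_smul, hn]
        have : RCLike.re (((β ^ 2 : ℝ) : ℂ) * (starRingEnd ℂ) ((β : ℂ) ^ 2)) = β ^ 4 := by
          rw [← Complex.ofReal_pow, Complex.conj_ofReal, ← Complex.ofReal_mul]
          change β ^ 2 * β ^ 2 = β ^ 4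
          ring
        erw [this]
        simp only [Complex.norm_real, Real.norm_eq_abs, abs_pow, mul_one, sq_abs]
        nlinarith [norm_nonneg z]
      nlinarith [norm_nonneg (z - ((β ^ 2 : ℝ) : ℂ) • x₀)]
    intro y hy
    rw [← key y hy, hd, inner_smul_right]

/-- Non attaining families. -/
lemma an_no_family [CompleteSpace H] {T : H →L[ℂ] H} (hT : IsAbsNormAttaining T) {ι : Type*}
    [Nonempty ι] (u : ι → H) (hu : Orthonormal ℂ u)
    (hTu : ∀ i j, i ≠ j → inner ℂ (T (u i)) (T (u j)) = 0)
    (hsup : ∀ i, ∃ j, ‖T (u i)‖ < ‖T (u j)‖) : False := by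
  set M : Submodule ℂ H := (Submodule.span ℂ (Set.range u)).topologicalClosure with hMdef
  have huM : ∀ i, u i ∈ M := fun i =>
    Submodule.le_topologicalClosure _ (Submodule.subset_span ⟨i, rfl⟩)
  have hM0 : M ≠ ⊥ := by
    intro h
    obtain ⟨i⟩ := ‹Nonempty ι›
    have := huM i
    rw [h, Submodule.mem_bot] at this
    exact hu.ne_zero i this
  have ext : ∀ (f : H →L[ℂ] ℂ), (∀ i, f (u i) = 0) → ∀ x ∈ M, f x = 0 := by
    intro f hf x hx
    have hle : M ≤ LinearMap.ker (f : H →ₗ[ℂ] ℂ) := by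
      refine Submodule.topologicalClosure_minimal _ ?_ f.isClosed_ker
      rw [Submodule.span_le]
      rintro _ ⟨i, rfl⟩
      exact hf i
    exact hle hx
  obtain ⟨x₀, hx₀, hn, β, hβ, hle, hv⟩ :=
    an_variational hT M (Submodule.isClosed_topologicalClosure _) hM0
  have hlt : ∀ i, ‖T (u i)‖ < β := by
    intro i
    obtain ⟨j, hj⟩ := hsup i
    have := hle _ (huM j)
    rw [hu.1 j, mul_one] at this
    linarith
  have hin : ∀ i, inner ℂ (u i) x₀ = 0 := by
    intro i
    have h1 := ext ((innerSL ℂ (T (u i))).comp T - ((‖T (u i)‖ ^ 2 : ℝ) : ℂ) • innerSL ℂ (u i)) (by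
      intro j
      by_cases hij : i = j
      · subst hij
        simp [inner_self_eq_norm_sq_to_K, hu.1 i]
      · simp [hTu i j hij, hu.2 hij]) x₀ hx₀
    simp only [sub_apply, comp_apply, innerSL_apply_apply, smul_apply, smul_eq_mul] at h1
    rw [hv _ (huM i), ← sub_mul, mul_eq_zero] at h1
    rcases h1 with h1 | h1
    · rw [← Complex.ofReal_sub, Complex.ofReal_eq_zero] at h1
      nlinarith [hlt i, norm_nonneg (T (u i))]
    · exact h1
  have h2 := ext (innerSL ℂ x₀) (fun i => by
    simp only [innerSL_apply_apply]
    rw [← inner_conj_symm, hin i, map_zero]) x₀ hx₀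
  simp only [innerSL_apply_apply, inner_self_eq_zero] at h2
  rw [h2, norm_zero] at hn
  exact zero_ne_one hn

/-- eigenvector in an invariant subspace -/
lemma an_eigen [CompleteSpace H] {A : H →L[ℂ] H} (hT : IsAbsNormAttaining A)
    (hA : IsSelfAdjoint A)
    (M : Submodule ℂ H) (hM : IsClosed (M : Set H)) (hM0 : M ≠ ⊥) (hinv : ∀ x ∈ M, A x ∈ M) :
    ∃ x ∈ M, x ≠ 0 ∧ ∃ μ : ℝ, A x = (μ : ℂ) • x := by
  obtain ⟨x₀, hx₀, hn, β, hβ, hle, hv⟩ := an_variational hT M hM hM0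
  have hx0 : x₀ ≠ 0 := by rintro rfl; simp at hn
  have hsym : ∀ x y, inner ℂ (A x) y = inner ℂ x (A y) := hA.isSymmetric
  have h2 : A (A x₀) = ((β ^ 2 : ℝ) : ℂ) • x₀ := by
    rw [← sub_eq_zero, ← @inner_self_eq_zero ℂ]
    set y := A (A x₀) - ((β ^ 2 : ℝ) : ℂ) • x₀ with hy
    have hyM : y ∈ M := M.sub_mem (hinv _ (hinv _ hx₀)) (M.smul_mem _ hx₀)
    have := hv y hyM
    rw [hsym] at this
    conv_lhs => rw [hy]
    rw [← hy, hy, inner_sub_right, ← hy, this, inner_smul_right, sub_self]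
  by_cases hc : A x₀ - (β : ℂ) • x₀ = 0
  · exact ⟨x₀, hx₀, hx0, β, sub_eq_zero.mp hc⟩
  · refine ⟨_, M.sub_mem (hinv _ hx₀) (M.smul_mem (β : ℂ) hx₀), hc, -β, ?_⟩
    rw [map_sub, map_smul, h2]
    push_cast
    module

lemma an_basis [CompleteSpace H] {A : H →L[ℂ] H} (hT : IsAbsNormAttaining A)
    (hA : IsSelfAdjoint A) :
    ∃ (s : Set H) (b : HilbertBasis s ℂ H) (lam : s → ℝ), ∀ i, A (b i) = (lam i : ℂ) • b i := by
  obtain ⟨s, hs⟩ := zorn_subset {s : Set H | Orthonormal ℂ ((↑) : s → H) ∧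
      ∀ x ∈ s, ∃ μ : ℝ, A x = (μ : ℂ) • x} (by
    intro c hc hchain
    refine ⟨⋃₀ c, ⟨orthonormal_sUnion_of_directed hchain.directedOn fun x hx => (hc hx).1, ?_⟩,
      fun t ht => Set.subset_sUnion_of_mem ht⟩
    rintro x ⟨t, ht, hx⟩
    exact (hc ht).2 x hx)
  obtain ⟨⟨hon, heig⟩, hmax⟩ := hs
  have hsym : ∀ x y, inner ℂ (A x) y = inner ℂ x (A y) := hA.isSymmetric
  have horth : ∀ x, x ∈ (Submodule.span ℂ s)ᗮ ↔ ∀ e ∈ s, inner ℂ e x = 0 := by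
    intro x
    constructor
    · intro hx e he
      exact hx e (Submodule.subset_span he)
    · intro hx
      rw [Submodule.mem_orthogonal]
      intro u hu
      induction hu using Submodule.span_induction with
      | mem x h => exact hx _ h
      | zero => simp
      | add x y _ _ h1 h2 => rw [inner_add_left, h1, h2, add_zero]
      | smul a x _ h => rw [inner_smul_left, h, mul_zero]
  have hbot : (Submodule.span ℂ s)ᗮ = ⊥ := by
    by_contra hne
    obtain ⟨x, hxM, hx0, μ, hμ⟩ := an_eigen hT hA _ (Submodule.isClosed_orthogonal _) hne (by
      intro x hx
      rw [horth] at hx ⊢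
      intro e he
      obtain ⟨μ, hμ⟩ := heig e he
      rw [← hsym, hμ, inner_smul_left, hx e he, mul_zero])
    set y : H := ((‖x‖⁻¹ : ℝ) : ℂ) • x with hy
    have hyn : ‖y‖ = 1 := by rw [hy, norm_smul]; simp [hx0]
    have hyo : ∀ e ∈ s, inner ℂ e y = 0 := by
      intro e he
      rw [hy, inner_smul_right, (horth x).mp hxM e he, mul_zero]
    have hys : y ∉ s := by
      intro h
      have := hyo y h
      rw [inner_self_eq_zero] at this
      rw [this] at hyn
      simp at hyn
    have hins : insert y s ∈ {s : Set H | Orthonormal ℂ ((↑) : s → H) ∧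
      ∀ x ∈ s, ∃ μ : ℝ, A x = (μ : ℂ) • x} := by
      refine ⟨⟨?_, ?_⟩, ?_⟩
      · rintro ⟨z, hz⟩
        rcases hz with rfl | hz
        · exact hyn
        · exact hon.1 ⟨z, hz⟩
      · rintro ⟨z, hz⟩ ⟨w, hw⟩ hzw
        have hzw' : z ≠ w := fun h => hzw (Subtype.ext h)
        change inner ℂ z w = 0
        rcases hz with rfl | hz <;> rcases hw with rfl | hw
        · exact absurd rfl hzw'
        · rw [← inner_conj_symm, hyo w hw, map_zero]
        · exact hyo z hz
        · exact hon.2 (i := ⟨z, hz⟩) (j := ⟨w, hw⟩) (fun h => hzw' (congrArg Subtype.val h))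
      · rintro z (rfl | hz)
        · refine ⟨μ, ?_⟩
          rw [hy, map_smul, hμ, smul_comm]
        · exact heig z hz
    exact hys (hmax hins (Set.subset_insert _ _) (Set.mem_insert _ _))
  have hbot' : (Submodule.span ℂ (Set.range ((↑) : s → H)))ᗮ = ⊥ := by
    rwa [Subtype.range_coe]
  choose lam hlam using fun i : s => heig i i.2
  refine ⟨s, HilbertBasis.mkOfOrthogonalEqBot hon hbot', lam, fun i => ?_⟩
  rw [HilbertBasis.coe_mkOfOrthogonalEqBot]
  exact hlam i

lemma compact_of_diag [CompleteSpace H] {ι : Type*} (b : HilbertBasis ι ℂ H) (K : H →L[ℂ] H)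
    (hK : IsSelfAdjoint K) (κ : ι → ℝ) (hb : ∀ i, K (b i) = (κ i : ℂ) • b i)
    (hfin : ∀ ε > 0, {i | ε ≤ |κ i|}.Finite) : IsCompactOperator K := by
  classical
  have hrepr : ∀ x i, b.repr (K x) i = κ i * b.repr x i := by
    intro x i
    have hsym : ∀ x y, inner ℂ (K x) y = inner ℂ x (K y) := hK.isSymmetric
    rw [b.repr_apply_apply, b.repr_apply_apply, ← hsym, hb, inner_smul_left, Complex.conj_ofReal]
  have hclosed := isClosed_setOfPred_isCompactOperator (σ₁₂ := RingHom.id ℂ) (M₁ := H) (M₂ := H)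
  have : K ∈ closure {f : H →L[ℂ] H | IsCompactOperator f} := by
    rw [Metric.mem_closure_iff]
    intro ε hε
    set S := (hfin (ε / 2) (half_pos hε)).toFinset with hS
    set F : H →L[ℂ] H := ∑ i ∈ S, (toSpanSingleton ℂ (b i)).comp
      ((κ i : ℂ) • innerSL ℂ (b i)) with hF
    have hFx : ∀ x i, b.repr (F x) i = if i ∈ S then κ i * b.repr x i else 0 := by
      intro x i
      rw [b.repr_apply_apply, hF]
      simp only [sum_apply, comp_apply, toSpanSingleton_apply, smul_apply,
        innerSL_apply_apply, inner_sum, inner_smul_right, smul_eq_mul,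
        orthonormal_iff_ite.mp b.orthonormal, b.repr_apply_apply]
      simp
    refine ⟨F, ?_, ?_⟩
    · have : F ∈ compactOperator (RingHom.id ℂ) H H := by
        refine Submodule.sum_mem _ fun i _ => ?_
        have h1 : IsCompactOperator ((κ i : ℂ) • innerSL ℂ (b i) : H →L[ℂ] ℂ) :=
          isCompactOperator_of_locallyCompactSpace_dom _
        exact h1.clm_comp (toSpanSingleton ℂ (b i))
      exact this
    · rw [dist_eq_norm]
      refine lt_of_le_of_lt (opNorm_le_bound _ (half_pos hε).le fun x => ?_) (half_lt_self hε)
      have h1 : ‖b.repr ((K - F) x)‖ ≤ ‖b.repr (((ε / 2 : ℝ) : ℂ) • x)‖ := by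
        refine lp.norm_mono (by simp) fun i => ?_
        have e1 : b.repr ((K - F) x) i = b.repr (K x) i - b.repr (F x) i := by
          rw [sub_apply, map_sub]; rfl
        have e2 : b.repr (((ε / 2 : ℝ) : ℂ) • x) i = ((ε / 2 : ℝ) : ℂ) * b.repr x i := by
          rw [map_smul]; rfl
        rw [e1, e2, hrepr, hFx]
        split_ifs with h
        · rw [sub_self, norm_zero]
          exact norm_nonneg _
        · have : |κ i| < ε / 2 := by
            simpa [hS] using h
          rw [sub_zero, norm_mul, norm_mul, Complex.norm_real, Complex.norm_real,
            Real.norm_eq_abs, Real.norm_eq_abs, abs_of_pos (half_pos hε)]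
          exact mul_le_mul_of_nonneg_right this.le (norm_nonneg _)
      rw [LinearIsometryEquiv.norm_map, LinearIsometryEquiv.norm_map, norm_smul, Complex.norm_real,
        Real.norm_eq_abs, abs_of_pos (half_pos hε)] at h1
      exact h1
  rw [hclosed.closure_eq] at this
  exact this

lemma an_no_gap [CompleteSpace H] {A : H →L[ℂ] H} (hT : IsAbsNormAttaining A) {ι : Type*}
    (b : HilbertBasis ι ℂ H) (lam : ι → ℝ) (hb : ∀ i, A (b i) = (lam i : ℂ) • b i)
    (h0 : ∀ i, 0 ≤ lam i) (c d : ℝ) (hcd : c < d)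
    (hc : {i | lam i ≤ c}.Infinite) (hd : {i | d ≤ lam i}.Infinite) : False := by
  classical
  have hon := orthonormal_iff_ite.mp b.orthonormal
  have hc0 : 0 ≤ c := by
    obtain ⟨i, hi⟩ := hc.nonempty
    exact (h0 i).trans hi
  let p : ℕ → ι := fun n => hc.natEmbedding _ n
  let q : ℕ → ι := fun n => hd.natEmbedding _ n
  have hp : ∀ n, lam (p n) ≤ c := fun n => (hc.natEmbedding _ n).2
  have hq : ∀ n, d ≤ lam (q n) := fun n => (hd.natEmbedding _ n).2
  have hpi : ∀ m n, p m = p n ↔ m = n := fun m n => by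
    simp only [p, Subtype.coe_inj, EmbeddingLike.apply_eq_iff_eq]
  have hqi : ∀ m n, q m = q n ↔ m = n := fun m n => by
    simp only [q, Subtype.coe_inj, EmbeddingLike.apply_eq_iff_eq]
  have hpq : ∀ m n, p m ≠ q n := fun m n h => by
    have h1 := hp m
    have h2 := hq n
    rw [h] at h1
    linarith
  have hqp : ∀ m n, q m ≠ p n := fun m n h => hpq n m h.symm
  let τ : ℕ → ℝ := fun n => d ^ 2 - (d ^ 2 - c ^ 2) / (n + 2)
  have hgap : 0 < d ^ 2 - c ^ 2 := by nlinarith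
  have hτ1 : ∀ n, c ^ 2 ≤ τ n := fun n => by
    have : (d ^ 2 - c ^ 2) / ((n : ℝ) + 2) ≤ d ^ 2 - c ^ 2 :=
      div_le_self hgap.le (by have := Nat.cast_nonneg (α := ℝ) n; linarith)
    simp only [τ]; linarith
  have hτ2 : ∀ n, τ n ≤ d ^ 2 := fun n => by
    have : 0 ≤ (d ^ 2 - c ^ 2) / ((n : ℝ) + 2) := by positivity
    simp only [τ]; linarith
  have hτ3 : ∀ n, τ n < τ (n + 1) := fun n => by
    have : (d ^ 2 - c ^ 2) / (((n + 1 : ℕ) : ℝ) + 2) < (d ^ 2 - c ^ 2) / ((n : ℝ) + 2) :=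
      div_lt_div_of_pos_left hgap (by positivity) (by push_cast; linarith)
    simp only [τ]; linarith
  have hex : ∀ n, ∃ x y : ℝ, x ^ 2 + y ^ 2 = 1 ∧
      x ^ 2 * lam (p n) ^ 2 + y ^ 2 * lam (q n) ^ 2 = τ n := by
    intro n
    have h1 : lam (p n) ^ 2 ≤ c ^ 2 := by nlinarith [hp n, h0 (p n)]
    have h2 : d ^ 2 ≤ lam (q n) ^ 2 := by nlinarith [hq n]
    have h3 : 0 < lam (q n) ^ 2 - lam (p n) ^ 2 := by linarith
    refine ⟨√((lam (q n) ^ 2 - τ n) / (lam (q n) ^ 2 - lam (p n) ^ 2)),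
      √((τ n - lam (p n) ^ 2) / (lam (q n) ^ 2 - lam (p n) ^ 2)), ?_⟩
    rw [Real.sq_sqrt (div_nonneg (by linarith [hτ2 n]) h3.le),
      Real.sq_sqrt (div_nonneg (by linarith [hτ1 n]) h3.le)]
    constructor
    · field_simp; ring
    · field_simp; ring
  choose x y hxy hxyτ using hex
  let u : ℕ → H := fun n => (x n : ℂ) • b (p n) + (y n : ℂ) • b (q n)
  have hAu : ∀ n, A (u n) = ((x n * lam (p n) : ℝ) : ℂ) • b (p n)
      + ((y n * lam (q n) : ℝ) : ℂ) • b (q n) := fun n => by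
    simp only [u, map_add, map_smul, hb, smul_smul]
    push_cast
    rfl
  have hgen : ∀ (r s r' s' : ℝ) m n, inner ℂ ((r : ℂ) • b (p m) + (s : ℂ) • b (q m))
      ((r' : ℂ) • b (p n) + (s' : ℂ) • b (q n)) = if m = n then ((r * r' + s * s' : ℝ) : ℂ) else 0 := by
    intro r s r' s' m n
    simp only [inner_add_left, inner_add_right, inner_smul_left, inner_smul_right, hon, hpi, hqi,
      hpq, hqp, Complex.conj_ofReal, if_false]
    split_ifs
    · push_cast; ring
    · simp
  have hAn : ∀ n, ‖A (u n)‖ ^ 2 = τ n := by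
    intro n
    have h1 := inner_self_eq_norm_sq_to_K (𝕜 := ℂ) (A (u n))
    rw [hAu, hgen, if_pos rfl] at h1
    rw [← hAu] at h1
    have h3 : ((x n * lam (p n) * (x n * lam (p n)) + y n * lam (q n) * (y n * lam (q n)) : ℝ) : ℂ)
      = ((‖A (u n)‖ ^ 2 : ℝ) : ℂ) := by rw [h1]; norm_cast
    rw [← Complex.ofReal_injective h3, ← hxyτ n]
    ring
  refine an_no_family hT u ?_ ?_ ?_
  · rw [orthonormal_iff_ite]
    intro m n
    rw [hgen]
    split_ifs with h
    · subst h
      rw [← Complex.ofReal_one, ← hxy m]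
      congr 1; ring
    · rfl
  · intro m n hmn
    rw [hAu, hAu, hgen, if_neg hmn]
  · intro n
    refine ⟨n + 1, ?_⟩
    refine lt_of_pow_lt_pow_left₀ 2 (norm_nonneg _) ?_
    rw [hAn, hAn]
    exact hτ3 n

lemma an_forward [CompleteSpace H] (h_inf : ¬ FiniteDimensional ℂ H) {A : H →L[ℂ] H}
    (hT : IsAbsNormAttaining A) (hA : IsSelfAdjoint A)
    (hpos : ∀ x, 0 ≤ (inner ℂ x (A x) : ℂ).re) :
    ∃ α : ℝ, 0 ≤ α ∧ essSpectrum A = {(α : ℂ)} ∧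
      {lam : ℝ | (lam : ℂ) ∈ spectrum ℂ A ∧ lam < α}.Finite := by
  classical
  obtain ⟨s, b, lam, hb⟩ := an_basis hT hA
  have hbn : ∀ i, ‖b i‖ = 1 := fun i => b.orthonormal.1 i
  have h0 : ∀ i, 0 ≤ lam i := by
    intro i
    have := hpos (b i)
    rw [hb, inner_smul_right, inner_self_eq_norm_sq_to_K, hbn] at this
    simpa using this
  have hnA : ∀ i, ‖A (b i)‖ = lam i := fun i => by
    rw [hb, norm_smul, hbn, Complex.norm_real, Real.norm_eq_abs, abs_of_nonneg (h0 i), mul_one]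
  have hle : ∀ i, lam i ≤ ‖A‖ := fun i => by
    have := A.le_opNorm (b i)
    rwa [hnA, hbn, mul_one] at this
  have hinf : Infinite s := by
    by_contra hfin
    rw [not_infinite_iff_finite] at hfin
    have := Fintype.ofFinite s
    exact h_inf (b.toOrthonormalBasis.toBasis.finiteDimensional_of_finite)
  set W : Set ℝ := {t | {i | lam i < t}.Infinite} with hW
  have hWne : W.Nonempty := by
    refine ⟨‖A‖ + 1, ?_⟩
    have : {i | lam i < ‖A‖ + 1} = Set.univ := by
      ext i
      simp only [Set.mem_ofPred_eq, Set.mem_univ, iff_true]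
      linarith [hle i]
    change {i | lam i < ‖A‖ + 1}.Infinite
    rw [this]
    exact Set.infinite_univ
  have hWb : ∀ t ∈ W, 0 ≤ t := by
    intro t ht
    obtain ⟨i, hi⟩ := Set.Infinite.nonempty ht
    exact (h0 i).trans (le_of_lt hi)
  set α := sInf W with hα
  have hα0 : 0 ≤ α := le_csInf hWne hWb
  have hbel : ∀ t < α, {i | lam i < t}.Finite := by
    intro t ht
    by_contra hc
    exact absurd (csInf_le ⟨0, hWb⟩ (show t ∈ W from hc)) (not_le.mpr ht)
  have habove : ∀ t, α < t → {i | lam i ≤ t}.Infinite := by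
    intro t ht
    obtain ⟨w, hw, hwt⟩ := exists_lt_of_csInf_lt hWne ht
    refine Set.Infinite.mono ?_ (show {i | lam i < w}.Infinite from hw)
    intro i hi
    exact (lt_trans hi hwt).le
  have hfin1 : {i | lam i < α}.Finite := by
    by_contra hc
    change Set.Infinite _ at hc
    have : Nonempty {i | lam i < α} := hc.nonempty.to_subtype
    refine an_no_family hT (fun i : {i | lam i < α} => b i)
      (b.orthonormal.comp _ Subtype.val_injective) ?_ ?_
    · intro i j hij
      rw [hb, hb, inner_smul_left, inner_smul_right, b.orthonormal.2 (fun h => hij (Subtype.ext h))]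
      simp
    · rintro ⟨i, hi⟩
      by_contra hno
      push Not at hno
      refine hc ((hbel ((lam i + α) / 2) ?_).subset ?_)
      · have : lam i < α := hi
        linarith
      · intro j hj
        have h1 := hno ⟨j, hj⟩
        simp only [hnA] at h1
        have : lam i < α := hi
        change lam j < _
        linarith
  have hfin2 : ∀ ε > 0, {i | ε ≤ |lam i - α|}.Finite := by
    intro ε hε
    have h3 : {i | α + ε ≤ lam i}.Finite := by
      by_contra hc
      exact an_no_gap hT b lam hb h0 (α + ε / 2) (α + ε) (by linarith)
        (habove _ (by linarith)) hc
    refine (hfin1.union h3).subset ?_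
    intro i hi
    change ε ≤ |lam i - α| at hi
    by_cases h : lam i < α
    · exact Or.inl h
    · right
      rw [abs_of_nonneg (by linarith)] at hi
      change α + ε ≤ lam i
      linarith
  have hcomp : IsCompactOperator (A - (α : ℂ) • 1 : H →L[ℂ] H) := by
    refine compact_of_diag b _ ?_ (fun i => lam i - α) ?_ hfin2
    · refine hA.sub ?_
      refine IsSelfAdjoint.smul ?_ (IsSelfAdjoint.one _)
      exact Complex.conj_ofReal α
    · intro i
      simp only [sub_apply, smul_apply, one_apply_eq_self, hb, Complex.ofReal_sub, sub_smul]
  refine ⟨α, hα0, ?_, ?_⟩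
  · ext z
    simp only [essSpectrum, Set.mem_ofPred_eq, Set.mem_singleton_iff]
    constructor
    · intro h
      by_contra hz
      refine h ⟨(α - z)⁻¹ • 1, ?_⟩
      have hz' : (α : ℂ) - z ≠ 0 := sub_ne_zero.mpr (Ne.symm hz)
      have e1 : A - z • 1 = (A - (α : ℂ) • 1) + (α - z) • (1 : H →L[ℂ] H) := by
        module
      have e2 : ((α - z)⁻¹ • 1) * (A - z • 1) - 1 = ((α : ℂ) - z)⁻¹ • (A - (α : ℂ) • 1 : H →L[ℂ] H) := by
        rw [e1, smul_mul_assoc, one_mul, smul_add, smul_smul, inv_mul_cancel₀ hz', one_smul]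
        abel
      have e3 : (A - z • 1) * ((α - z)⁻¹ • 1) - 1 = ((α : ℂ) - z)⁻¹ • (A - (α : ℂ) • 1 : H →L[ℂ] H) := by
        rw [e1, mul_smul_comm, mul_one, smul_add, smul_smul, inv_mul_cancel₀ hz', one_smul]
        abel
      rw [e2, e3]
      exact ⟨hcomp.smul _, hcomp.smul _⟩
    · rintro rfl ⟨S, hS, -⟩
      have h1 : IsCompactOperator (S * (A - (α : ℂ) • 1) : H →L[ℂ] H) := hcomp.clm_comp S
      have h2 := h1.sub hS
      refine h_inf (FiniteDimensional.of_isCompactOperator_id (𝕜 := ℂ) ?_)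
      have h3 : (id : H → H) = (⇑(S * (A - (α : ℂ) • 1)) - ⇑(S * (A - (α : ℂ) • 1) - 1)) := by
        funext x
        simp
      rw [h3]
      exact h2
  · refine (hfin1.image lam).subset ?_
    rintro t ⟨ht, htα⟩
    have hne : ((t - α : ℝ) : ℂ) ≠ 0 := by
      rw [Complex.ofReal_ne_zero]; linarith
    have hsp : ((t - α : ℝ) : ℂ) ∈ spectrum ℂ (A - (α : ℂ) • 1 : H →L[ℂ] H) := by
      rw [spectrum.mem_iff] at ht ⊢
      convert ht using 2
      simp only [Algebra.algebraMap_eq_smul_one]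
      push_cast
      module
    have hev := (hcomp.hasEigenvalue_iff_mem_spectrum hne).mpr hsp
    obtain ⟨v, hv⟩ := hev.exists_hasEigenvector
    have hv1 : A v = (t : ℂ) • v := by
      have := hv.apply_eq_smul
      simp only [coe_coe, sub_apply, smul_apply, one_apply_eq_self] at this
      rw [sub_eq_iff_eq_add] at this
      rw [this]
      push_cast
      module
    have hsym : ∀ x y, inner ℂ (A x) y = inner ℂ x (A y) := hA.isSymmetric
    have : ∃ i, b.repr v i ≠ 0 := by
      by_contra hno
      push Not at hno
      apply hv.2
      have : b.repr v = 0 := by ext i; exact hno i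
      simpa using this
    obtain ⟨i, hi⟩ := this
    rw [b.repr_apply_apply] at hi
    have h4 := hsym (b i) v
    rw [hb, hv1, inner_smul_left, inner_smul_right, Complex.conj_ofReal] at h4
    have h5 := Complex.ofReal_injective (mul_right_cancel₀ hi h4)
    exact ⟨i, by change lam i < α; rw [h5]; exact htα, h5⟩

lemma compact_cfc_of_ess [CompleteSpace H] {A : H →L[ℂ] H} (hA : IsSelfAdjoint A) (α : ℝ)
    (hess : essSpectrum A ⊆ {(α : ℂ)}) (f : C(spectrum ℝ A, ℝ))
    (hf : ∀ x : spectrum ℝ A, (x : ℝ) = α → f x = 0) :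
    IsCompactOperator (cfcHom hA f : H →L[ℂ] H) := by
  let J : Ideal C(spectrum ℝ A, ℝ) :=
    { carrier := {g | IsCompactOperator (cfcHom hA g : H →L[ℂ] H)}
      zero_mem' := by
        change IsCompactOperator (cfcHom hA 0 : H →L[ℂ] H)
        rw [map_zero]
        exact isCompactOperator_zero
      add_mem' := by
        intro g h hg hh
        change IsCompactOperator (cfcHom hA (g + h) : H →L[ℂ] H)
        rw [map_add]
        exact IsCompactOperator.add hg hh
      smul_mem' := by
        intro g h hh
        change IsCompactOperator (cfcHom hA (g * h) : H →L[ℂ] H)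
        rw [map_mul]
        exact IsCompactOperator.clm_comp hh (cfcHom hA g : H →L[ℂ] H) }
  have hJ : ∀ g, g ∈ J ↔ IsCompactOperator (cfcHom hA g : H →L[ℂ] H) := fun g => Iff.rfl
  have hclosed := isClosed_setOfPred_isCompactOperator (σ₁₂ := RingHom.id ℂ) (M₁ := H) (M₂ := H)
  have hJc : IsClosed (J : Set C(spectrum ℝ A, ℝ)) := hclosed.preimage (cfcHom_continuous hA)
  rw [← hJ, ← ContinuousMap.idealOfSet_ofIdeal_isClosed hJc, ContinuousMap.mem_idealOfSet]
  intro x hx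
  apply hf
  by_contra hxα
  apply hx
  rw [ContinuousMap.mem_setOfIdeal]
  -- a bump function
  obtain ⟨S, hS, -⟩ : ∃ S : H →L[ℂ] H,
      IsCompactOperator (S * (A - ((x : ℝ) : ℂ) • 1) - 1 : H →L[ℂ] H) ∧
      IsCompactOperator ((A - ((x : ℝ) : ℂ) • 1) * S - 1 : H →L[ℂ] H) := by
    by_contra hno
    have := hess (show ((x : ℝ) : ℂ) ∈ essSpectrum A from hno)
    exact hxα (Complex.ofReal_injective this)
  set δ : ℝ := (‖S‖ + 1)⁻¹ with hδ
  have hδ0 : 0 < δ := by positivity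
  let g : C(spectrum ℝ A, ℝ) := ⟨fun y => max 0 (δ - |(y : ℝ) - x|), by fun_prop⟩
  let k : C(spectrum ℝ A, ℝ) := ⟨fun y => max (-δ) (min δ ((y : ℝ) - x)), by fun_prop⟩
  let l : C(spectrum ℝ A, ℝ) := ⟨fun y => (y : ℝ) - x, by fun_prop⟩
  have hlk : l * g = k * g := by
    ext y
    simp only [l, k, g, ContinuousMap.mul_apply, ContinuousMap.coe_mk]
    by_cases h : |(y : ℝ) - x| ≤ δ
    · rw [abs_le] at h
      rw [min_eq_right h.2, max_eq_right h.1]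
    · rw [max_eq_left (by linarith : δ - |(y : ℝ) - x| ≤ 0), mul_zero, mul_zero]
  have hk : ‖k‖ ≤ δ := by
    rw [ContinuousMap.norm_le _ hδ0.le]
    intro y
    simp only [k, ContinuousMap.coe_mk, Real.norm_eq_abs]
    rw [abs_le]
    exact ⟨le_max_left _ _, max_le (by linarith) (min_le_left _ _)⟩
  have hl : cfcHom hA l = A - ((x : ℝ) : ℂ) • 1 := by
    have : l = (ContinuousMap.id ℝ).restrict (spectrum ℝ A) - algebraMap ℝ _ (x : ℝ) := by
      ext y; simp [l]
    rw [this, map_sub, cfcHom_id hA, AlgHomClass.commutes, Algebra.algebraMap_eq_smul_one]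
    rfl
  refine ⟨g, ?_, by simpa [g] using hδ0⟩
  rw [hJ]
  have hnorm : ‖S * cfcHom hA k‖ < 1 := by
    refine (norm_mul_le _ _).trans_lt ?_
    rw [norm_cfcHom A k hA]
    calc ‖S‖ * ‖k‖ ≤ ‖S‖ * δ := mul_le_mul_of_nonneg_left hk (norm_nonneg _)
      _ < (‖S‖ + 1) * δ := by nlinarith
      _ = 1 := mul_inv_cancel₀ (by positivity)
  obtain ⟨U, hU⟩ := isUnit_one_sub_of_norm_lt_one hnorm
  have e1 : (1 - S * cfcHom hA k) * cfcHom hA g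
      = -((S * (A - ((x : ℝ) : ℂ) • 1) - 1) * cfcHom hA g) := by
    have : cfcHom hA l * cfcHom hA g = cfcHom hA k * cfcHom hA g := by
      rw [← map_mul, hlk, map_mul]
    rw [← hl, sub_mul, sub_mul, mul_assoc, mul_assoc, this]
    abel
  have e2 : cfcHom hA g = (↑U⁻¹ : H →L[ℂ] H) *
      (-((S * (A - ((x : ℝ) : ℂ) • 1) - 1) * cfcHom hA g)) := by
    rw [← e1, ← hU, Units.inv_mul_cancel_left]
  rw [e2]
  have h3 : IsCompactOperator
      ((S * (A - ((x : ℝ) : ℂ) • 1) - 1) * cfcHom hA g : H →L[ℂ] H) := hS.comp_clm _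
  exact h3.neg.clm_comp (↑U⁻¹ : H →L[ℂ] H)

lemma an_backward_aux [CompleteSpace H] {A : H →L[ℂ] H} (hA : IsSelfAdjoint A) (α : ℝ) (hα : 0 ≤ α)
    (hess : essSpectrum A = {(α : ℂ)})
    (hfin : {lam : ℝ | (lam : ℂ) ∈ spectrum ℂ A ∧ lam < α}.Finite) :
    IsCompactOperator (A * A - ((α ^ 2 : ℝ) : ℂ) • 1 : H →L[ℂ] H) ∧
    ∃ Q : H →L[ℂ] H, IsCompactOperator Q ∧ Q * Q = Q ∧
      ∀ x, Q x = 0 → α * ‖x‖ ≤ ‖A x‖ := by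
  let i : C(spectrum ℝ A, ℝ) := (ContinuousMap.id ℝ).restrict (spectrum ℝ A)
  have hi : cfcHom hA i = A := cfcHom_id hA
  let c : C(spectrum ℝ A, ℝ) := algebraMap ℝ _ (α ^ 2)
  have hc : cfcHom hA c = ((α ^ 2 : ℝ) : ℂ) • 1 := by
    simp only [c]
    rw [AlgHomClass.commutes, Algebra.algebraMap_eq_smul_one]
    rfl
  have hB : cfcHom hA (i * i - c) = A * A - ((α ^ 2 : ℝ) : ℂ) • 1 := by
    rw [map_sub, map_mul, hi, hc]
  have hclopen : IsClopen {y : spectrum ℝ A | (y : ℝ) < α} := by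
    refine ⟨Set.Finite.isClosed ?_, isOpen_lt (by fun_prop) continuous_const⟩
    refine Set.Finite.of_finite_image (f := Subtype.val) (hfin.subset ?_)
      Subtype.val_injective.injOn
    rintro _ ⟨y, hy, rfl⟩
    refine ⟨?_, hy⟩
    have := (spectrum.algebraMap_mem_iff ℂ (R := ℝ) (a := A) (r := (y : ℝ))).mpr y.2
    exact this
  let p : C(spectrum ℝ A, ℝ) := ⟨Set.indicator {y : spectrum ℝ A | (y : ℝ) < α} 1,
    continuous_one.indicator (by simp [hclopen.frontier_eq])⟩
  have hp1 : ∀ y : spectrum ℝ A, (y : ℝ) < α → p y = 1 := fun y hy =>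
    Set.indicator_of_mem (s := {y : spectrum ℝ A | (y : ℝ) < α}) hy _
  have hp0 : ∀ y : spectrum ℝ A, ¬ (y : ℝ) < α → p y = 0 := fun y hy =>
    Set.indicator_of_notMem (s := {y : spectrum ℝ A | (y : ℝ) < α}) hy _
  refine ⟨?_, cfcHom hA p, ?_, ?_, ?_⟩
  · rw [← hB]
    refine compact_cfc_of_ess hA α hess.le _ ?_
    intro y hy
    simp [i, c, hy, sq]
  · refine compact_cfc_of_ess hA α hess.le _ ?_
    intro y hy
    exact hp0 y (by rw [hy]; exact lt_irrefl _)
  · rw [← map_mul]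
    congr 1
    ext y
    by_cases h : (y : ℝ) < α
    · simp [hp1 y h]
    · simp [hp0 y h]
  · intro x hx
    have hnn : 0 ≤ cfcHom hA ((i * i - c) * (1 - p)) := by
      rw [cfcHom_nonneg_iff hA]
      intro y
      by_cases h : (y : ℝ) < α
      · simp [hp1 y h]
      · change 0 ≤ ((y : ℝ) * y - α ^ 2) * (1 - p y)
        rw [hp0 y h]
        nlinarith
    rw [map_mul, hB, map_sub, map_one, nonneg_iff_isPositive] at hnn
    have h1 := hnn.re_inner_nonneg_right x
    have hsym : ∀ x y, inner ℂ (A x) y = inner ℂ x (A y) := hA.isSymmetric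
    have h2 : inner ℂ x (((A * A - ((α ^ 2 : ℝ) : ℂ) • 1) * (1 - cfcHom hA p)) x)
        = ((‖A x‖ ^ 2 - α ^ 2 * ‖x‖ ^ 2 : ℝ) : ℂ) := by
      simp only [mul_apply_eq_comp, sub_apply, one_apply_eq_self, hx, sub_zero, smul_apply,
        inner_sub_right, inner_smul_right]
      rw [← hsym, inner_self_eq_norm_sq_to_K, inner_self_eq_norm_sq_to_K]
      push_cast
      rfl
    rw [h2] at h1
    have h3 : 0 ≤ ‖A x‖ ^ 2 - α ^ 2 * ‖x‖ ^ 2 := h1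
    refine le_of_sq_le_sq ?_ (norm_nonneg _)
    rw [mul_pow]
    linarith

lemma an_backward [CompleteSpace H] {A : H →L[ℂ] H} (hA : IsSelfAdjoint A) (α : ℝ) (hα : 0 ≤ α)
    (hess : essSpectrum A = {(α : ℂ)})
    (hfin : {lam : ℝ | (lam : ℂ) ∈ spectrum ℂ A ∧ lam < α}.Finite) :
    IsAbsNormAttaining A := by
  obtain ⟨hB, Q, hQc, hQQ, hQ⟩ := an_backward_aux hA α hα hess hfin
  have hsym : ∀ x y, inner ℂ (A x) y = inner ℂ x (A y) := hA.isSymmetric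
  intro M hM hM0
  have : CompleteSpace M := hM.completeSpace_coe
  have hle := an_le_sSup A M
  have hbdd := an_bdd A M
  have hne : ((fun x => ‖A x‖) '' {x : H | x ∈ M ∧ ‖x‖ ≤ 1}).Nonempty :=
    ⟨_, 0, ⟨M.zero_mem, by simp⟩, rfl⟩
  have hlub := isLUB_csSup hne hbdd
  set β := sSup ((fun x => ‖A x‖) '' {x : H | x ∈ M ∧ ‖x‖ ≤ 1}) with hβ
  have hβ0 : 0 ≤ β := (norm_nonneg (A 0)).trans (hlub.1 ⟨0, ⟨M.zero_mem, by simp⟩, rfl⟩)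
  rcases lt_or_ge α β with hlt | hge
  · -- maximizing sequence
    obtain ⟨w, -, -, hw, hwm⟩ := hlub.exists_seq_monotone_tendsto hne
    choose x hx hxw using hwm
    have hxM : ∀ n, x n ∈ M := fun n => (hx n).1
    have hx1 : ∀ n, ‖x n‖ ≤ 1 := fun n => (hx n).2
    have hwA : Filter.Tendsto (fun n => ‖A (x n)‖) Filter.atTop (nhds β) := by
      simpa only [hxw] using hw
    set B : H →L[ℂ] H := A * A - ((α ^ 2 : ℝ) : ℂ) • 1 with hBdef
    set P := M.starProjection with hP
    have hPB : IsCompactOperator (P ∘ B) := hB.clm_comp P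
    set γ : ℝ := β ^ 2 - α ^ 2 with hγ
    have hγ0 : 0 < γ := by rw [hγ]; nlinarith
    have hest : ∀ n, ‖P (B (x n)) - (γ : ℂ) • x n‖ ^ 2 ≤ 2 * β ^ 2 * (β ^ 2 - ‖A (x n)‖ ^ 2) := by
      intro n
      set z := P (A (A (x n))) with hz
      have hzM : z ∈ M := Submodule.starProjection_apply_mem _ _
      have key : ∀ y ∈ M, inner ℂ y z = inner ℂ (A y) (A (x n)) := by
        intro y hy
        rw [hz, hP, ← Submodule.inner_starProjection_left_eq_right,
          Submodule.starProjection_eq_self_iff.mpr hy, hsym]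
      have e : P (B (x n)) - (γ : ℂ) • x n = z - ((β ^ 2 : ℝ) : ℂ) • x n := by
        have hPx : P (x n) = x n := Submodule.starProjection_eq_self_iff.mpr (hxM n)
        simp only [hBdef, sub_apply, mul_apply_eq_comp, smul_apply, one_apply_eq_self, map_sub,
          map_smul, hPx, hγ, ← hz]
        push_cast
        module
      have hAx : ‖A (x n)‖ ≤ β := (hle _ (hxM n)).trans (by nlinarith [hx1 n])
      have hzn : ‖z‖ ≤ β ^ 2 := by
        have h1 : ‖z‖ ^ 2 ≤ β ^ 2 * ‖z‖ := by
          have : ‖inner ℂ z z‖ ≤ ‖A z‖ * ‖A (x n)‖ := by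
            rw [key z hzM]; exact norm_inner_le_norm _ _
          rw [inner_self_eq_norm_sq_to_K] at this
          simp only [norm_pow, RCLike.norm_ofReal, abs_norm] at this
          have h5 : ‖A z‖ * ‖A (x n)‖ ≤ (β * ‖z‖) * β :=
            mul_le_mul (hle z hzM) hAx (norm_nonneg _) (by positivity)
          nlinarith
        by_contra hc
        push Not at hc
        have : 0 < ‖z‖ := lt_of_le_of_lt (by positivity) hc
        nlinarith
      rw [e, @norm_sub_sq ℂ, inner_smul_right, ← inner_conj_symm, key _ (hxM n),
        inner_self_eq_norm_sq_to_K, norm_smul]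
      have : RCLike.re (((β ^ 2 : ℝ) : ℂ) * (starRingEnd ℂ) ((‖A (x n)‖ : ℂ) ^ 2))
          = β ^ 2 * ‖A (x n)‖ ^ 2 := by
        rw [← Complex.ofReal_pow, Complex.conj_ofReal, ← Complex.ofReal_mul]
        rfl
      erw [this]
      simp only [Complex.norm_real, Real.norm_eq_abs, abs_pow, sq_abs]
      have h6 : ‖z‖ ^ 2 ≤ (β ^ 2) ^ 2 := pow_le_pow_left₀ (norm_nonneg _) hzn 2
      have h7 : (β ^ 2 * ‖x n‖) ^ 2 ≤ (β ^ 2) ^ 2 :=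
        pow_le_pow_left₀ (by positivity) (by nlinarith [hx1 n, sq_nonneg β]) 2
      nlinarith
    have hto : Filter.Tendsto (fun n => P (B (x n)) - (γ : ℂ) • x n) Filter.atTop (nhds 0) := by
      rw [tendsto_zero_iff_norm_tendsto_zero]
      have h1 : Filter.Tendsto (fun n => 2 * β ^ 2 * (β ^ 2 - ‖A (x n)‖ ^ 2)) Filter.atTop
          (nhds 0) := by
        have := ((tendsto_const_nhds (x := β ^ 2)).sub (hwA.pow 2)).const_mul (2 * β ^ 2)
        simpa using this
      have h2 := squeeze_zero (fun n => sq_nonneg _) hest h1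
      have h3 := h2.sqrt
      simpa [Real.sqrt_sq] using h3
    have hK := hPB.isCompact_closure_image_closedBall (𝕜₁ := ℂ) (f := (P.comp B : H →ₗ[ℂ] H)) 1
    obtain ⟨a, -, φ, hφ, ha⟩ := hK.tendsto_subseq (x := fun n => P (B (x n))) (fun n =>
      subset_closure ⟨x n, by simpa using hx1 n, rfl⟩)
    have h1 : Filter.Tendsto (fun n => (γ : ℂ)⁻¹ •
        (P (B (x (φ n))) - (P (B (x (φ n))) - (γ : ℂ) • x (φ n)))) Filter.atTop
        (nhds ((γ : ℂ)⁻¹ • (a - 0))) :=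
      (ha.sub (hto.comp hφ.tendsto_atTop)).const_smul _
    have hγc : (γ : ℂ) ≠ 0 := by exact_mod_cast hγ0.ne'
    simp only [sub_sub_cancel, inv_smul_smul₀ hγc] at h1
    refine ⟨_, hM.mem_of_tendsto h1 (Filter.Eventually.of_forall fun n => hxM _), ?_, ?_⟩
    · exact le_of_tendsto h1.norm (Filter.Eventually.of_forall fun n => hx1 _)
    · exact tendsto_nhds_unique (((A.continuous.tendsto _).comp h1).norm)
        (hwA.comp hφ.tendsto_atTop)
  · by_cases hker : ∃ x ∈ M, x ≠ 0 ∧ Q x = 0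
    · obtain ⟨x, hx, hx0, hQx⟩ := hker
      have hpos : 0 < ‖x‖ := norm_pos_iff.mpr hx0
      refine ⟨((‖x‖⁻¹ : ℝ) : ℂ) • x, M.smul_mem _ hx, ?_, ?_⟩
      · rw [norm_smul]; simp [hx0]
      · refine le_antisymm (hlub.1 ⟨_, ⟨M.smul_mem _ hx, ?_⟩, rfl⟩) ?_
        · rw [norm_smul]; simp [hx0]
        · rw [map_smul, norm_smul, Complex.norm_real, norm_inv, norm_norm, le_inv_mul_iff₀ hpos]
          nlinarith [hQ x hQx]
    · push Not at hker
      have hfd : FiniteDimensional ℂ (Module.End.eigenspace (Q : H →ₗ[ℂ] H) 1) :=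
        finite_dimensional_eigenspace hQc 1 one_ne_zero
      have hmem : ∀ x, Q x ∈ Module.End.eigenspace (Q : H →ₗ[ℂ] H) 1 := by
        intro x
        rw [Module.End.mem_eigenspace_iff, one_smul]
        exact congrArg (fun R : H →L[ℂ] H => R x) hQQ
      let L : M →ₗ[ℂ] Module.End.eigenspace (Q : H →ₗ[ℂ] H) 1 :=
        ((Q : H →ₗ[ℂ] H).codRestrict _ hmem).comp M.subtype
      have hL : Function.Injective L := by
        rw [injective_iff_map_eq_zero]
        intro m hm
        have h1 : Q m = 0 := congrArg Subtype.val hm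
        by_contra hm0
        exact hker m m.2 (fun h => hm0 (Subtype.ext h)) h1
      have : FiniteDimensional ℂ M := FiniteDimensional.of_injective L hL
      have : ProperSpace M := FiniteDimensional.proper ℂ M
      obtain ⟨m, hm, hmax⟩ := (isCompact_closedBall (0 : M) 1).exists_isMaxOn ⟨0, by simp⟩
        (f := fun m : M => ‖A m‖) (by fun_prop)
      have hm1 : ‖(m : H)‖ ≤ 1 := by simpa using hm
      refine ⟨m, m.2, hm1, le_antisymm (hlub.1 ⟨m, ⟨m.2, hm1⟩, rfl⟩) ?_⟩
      refine hlub.2 ?_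
      rintro _ ⟨y, ⟨hy, hy1⟩, rfl⟩
      exact hmax (show (⟨y, hy⟩ : M) ∈ Metric.closedBall (0 : M) 1 by simpa using hy1)

lemma norm_sqrt_apply [CompleteSpace H] (T : H →L[ℂ] H) (x : H) :
    ‖T x‖ = ‖CFC.sqrt (adjoint T * T) x‖ := by
  have hnn : 0 ≤ adjoint T * T := star_mul_self_nonneg T
  have hs : IsSelfAdjoint (CFC.sqrt (adjoint T * T)) := (CFC.sqrt_nonneg _).isSelfAdjoint
  have hsq := CFC.sqrt_mul_sqrt_self (adjoint T * T) hnn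
  set A := CFC.sqrt (adjoint T * T) with hA
  have hsym : ∀ x y, inner ℂ (A x) y = inner ℂ x (A y) := hs.isSymmetric
  have h1 : inner ℂ (T x) (T x) = inner ℂ (A x) (A x) := by
    rw [hsym, ← adjoint_inner_right]
    exact congrArg (fun R : H →L[ℂ] H => inner ℂ x (R x)) hsq.symm
  rw [@norm_eq_sqrt_re_inner ℂ, h1, ← @norm_eq_sqrt_re_inner ℂ]
end AN

/-- A bounded operator `T` on an infinite-dimensional complex Hilbert space is absolutely norm
attaining iff the essential spectrum of `|T| = (T*T)^{1/2}` is a singleton `{α}` with `α ≥ 0`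
and the spectrum of `|T|` contains only finitely many elements strictly less than `α`. -/
theorem isAbsNormAttaining_iff_abs_essSpectrum
    {H : Type*} [NormedAddCommGroup H] [InnerProductSpace ℂ H] [CompleteSpace H]
    (h_inf : ¬ FiniteDimensional ℂ H) (T : H →L[ℂ] H) :
    IsAbsNormAttaining T ↔
      ∃ α : ℝ, 0 ≤ α ∧
        essSpectrum (CFC.sqrt (ContinuousLinearMap.adjoint T * T)) = {(α : ℂ)} ∧
        {lam : ℝ | (lam : ℂ) ∈ spectrum ℂ (CFC.sqrt (ContinuousLinearMap.adjoint T * T)) ∧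
          lam < α}.Finite := by
  have hnn := CFC.sqrt_nonneg (ContinuousLinearMap.adjoint T * T)
  rw [an_congr (norm_sqrt_apply T)]
  constructor
  · intro h
    refine an_forward h_inf h hnn.isSelfAdjoint ?_
    rw [ContinuousLinearMap.nonneg_iff_isPositive] at hnn
    exact fun x => hnn.re_inner_nonneg_right x
  · rintro ⟨α, hα, hess, hfin⟩
    exact an_backward hnn.isSelfAdjoint α hα hess hfin
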